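/- Let (s, x₁, x₂) : [0, ∞) → ℝ³ be a C¹ solution of the random chemostat model with wall growth with nonnegative initial data, and set p(t) = s(t) + (m/c)(x₁(t) + x₂(t)) and ϑ = min{b₁, ν}. Then limsup_{t→∞} p(t) ≤ s_in b₂ / ϑ. Equivalently, for every ε > 0 there exists T ≥ 0 such that 0 ≤ p(t) ≤ s_in b₂/ϑ + ε for all t ≥ T; thus B_ε = {(s,x₁,x₂) ∈ 𝒳 : s + (m/c)(x₁+x₂) ≤ s_in b₂/ϑ + ε} is a deterministic compact absorbing set and B₀ = {(s,x₁,x₂) ∈ 𝒳 : s + (m/c)(x₁+x₂) ≤ s_in b₂/ϑ} is a deterministic attracting set, both forwards in time. -/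

import Mathlib

open Real Filter

lemma hasDerivAt_minsq (x : ℝ) : HasDerivAt (fun y : ℝ => (min y 0) ^ 2) (2 * min x 0) x := by
  rcases lt_trichotomy x 0 with h | h | h
  · rw [min_eq_left h.le]
    have h1 : HasDerivAt (fun y : ℝ => y ^ 2) (2 * x) x := by
      simpa using hasDerivAt_pow 2 x
    refine h1.congr_of_eventuallyEq ?_
    filter_upwards [Iio_mem_nhds h] with y hy
    rw [min_eq_left (le_of_lt hy)]
  · subst h
    rw [hasDerivAt_iff_isLittleO]
    have h1 : HasDerivAt (fun y : ℝ => y ^ 2) (2 * 0) (0 : ℝ) := by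
      simpa using hasDerivAt_pow 2 (0 : ℝ)
    rw [hasDerivAt_iff_isLittleO] at h1
    refine Asymptotics.IsBigO.trans_isLittleO ?_ h1
    refine Asymptotics.IsBigO.of_bound 1 (Eventually.of_forall fun y => ?_)
    simp only [min_self, mul_zero, smul_zero, sub_zero, Real.norm_eq_abs, one_mul]
    norm_num
    rcases le_total y 0 with h | h
    · simp [h]
    · simp [h]
  · rw [min_eq_right h.le]
    have h1 : HasDerivAt (fun y : ℝ => (0 : ℝ)) (2 * 0) x := by
      simpa using hasDerivAt_const x (0 : ℝ)
    refine h1.congr_of_eventuallyEq ?_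
    filter_upwards [Ioi_mem_nhds h] with y hy
    rw [min_eq_right (le_of_lt hy)]; norm_num

lemma gron (f f' : ℝ → ℝ) (C T : ℝ)
    (hf : ∀ t ∈ Set.Icc (0 : ℝ) T, HasDerivAt f (f' t) t)
    (hle : ∀ t ∈ Set.Icc (0 : ℝ) T, f' t ≤ C * f t) :
    ∀ t ∈ Set.Icc (0 : ℝ) T, f t ≤ f 0 * exp (C * t) := by
  have hd : ∀ t ∈ Set.Icc (0 : ℝ) T, HasDerivAt (fun t => f t * exp (-C * t))
      ((f' t - C * f t) * exp (-C * t)) t := by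
    intro t ht
    have h1 : HasDerivAt (fun t : ℝ => -C * t) (-C) t := by
      simpa using (hasDerivAt_id t).const_mul (-C)
    exact ((hf t ht).mul h1.exp).congr_deriv (by ring)
  have hanti : AntitoneOn (fun t => f t * exp (-C * t)) (Set.Icc 0 T) := by
    refine antitoneOn_of_deriv_nonpos (convex_Icc 0 T)
      (fun t ht => (hd t ht).continuousAt.continuousWithinAt)
      (fun t ht => (hd t (interior_subset ht)).differentiableAt.differentiableWithinAt) ?_
    intro t ht
    rw [(hd t (interior_subset ht)).deriv]
    exact mul_nonpos_of_nonpos_of_nonneg (by linarith [hle t (interior_subset ht)]) (exp_pos _).le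
  intro t ht
  have h := hanti ⟨le_refl 0, ht.1.trans ht.2⟩ ht ht.1
  simp only [mul_zero, exp_zero, mul_one] at h
  have h2 := mul_le_mul_of_nonneg_right h (exp_pos (C * t)).le
  rwa [mul_assoc, ← exp_add, neg_mul, neg_add_cancel, exp_zero, mul_one] at h2

/-- the deterministic absorbing/attracting bound for
`p = s + (m/c)(x₁ + x₂)` in the random chemostat model with wall growth. -/
theorem chemostat_wall_growth_absorbing_set
    (s_in a m c b ν r₁ r₂ b₁ b₂ : ℝ)
    (hs_in : 0 < s_in) (ha : 0 < a) (hc : 0 < c) (hcm : c ≤ m)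
    (hb : 0 < b) (hb1 : b ≤ 1) (hν : 0 < ν) (hr₁ : 0 < r₁) (hr₂ : 0 < r₂)
    (hb₁ : 0 < b₁) (hb₁₂ : b₁ ≤ b₂)
    (d : ℝ → ℝ) (hd_cont : Continuous d)
    (hd_bounds : ∀ t, b₁ ≤ d t ∧ d t ≤ b₂)
    (s x₁ x₂ : ℝ → ℝ)
    (h0 : 0 ≤ s 0 ∧ 0 ≤ x₁ 0 ∧ 0 ≤ x₂ 0)
    (hs : ∀ t ∈ Set.Ici (0:ℝ), HasDerivAt s
      (d t * (s_in - s t) - (m * s t / (a + s t)) * x₁ t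
        - (m * s t / (a + s t)) * x₂ t + b * ν * x₁ t) t)
    (hx₁ : ∀ t ∈ Set.Ici (0:ℝ), HasDerivAt x₁
      (-(ν + d t) * x₁ t + (c * s t / (a + s t)) * x₁ t - r₁ * x₁ t + r₂ * x₂ t) t)
    (hx₂ : ∀ t ∈ Set.Ici (0:ℝ), HasDerivAt x₂
      (-ν * x₂ t + (c * s t / (a + s t)) * x₂ t + r₁ * x₁ t - r₂ * x₂ t) t)
    (p : ℝ → ℝ) (hp : ∀ t, p t = s t + (m / c) * (x₁ t + x₂ t))
    (ϑ : ℝ) (hϑ : ϑ = min b₁ ν) :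
    limsup p atTop ≤ s_in * b₂ / ϑ ∧
    ∀ ε > 0, ∃ T ≥ (0:ℝ), ∀ t ≥ T, 0 ≤ p t ∧ p t ≤ s_in * b₂ / ϑ + ε := by
  have hm : 0 < m := hc.trans_le hcm
  have key : ∀ T : ℝ, (∀ t ∈ Set.Icc (0:ℝ) T, -a < s t) →
      ∀ t ∈ Set.Icc (0:ℝ) T, 0 ≤ s t ∧ 0 ≤ x₁ t ∧ 0 ≤ x₂ t := by
    intro T hT
    have hx : ∀ t ∈ Set.Icc (0:ℝ) T, 0 ≤ x₁ t ∧ 0 ≤ x₂ t := by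
      intro t ht
      have h := gron (fun t => (min (x₁ t) 0) ^ 2 + (min (x₂ t) 0) ^ 2) _ (2 * c + r₁ + r₂) T
        (fun t ht => ((hasDerivAt_minsq (x₁ t)).comp t (hx₁ t ht.1)).add
          ((hasDerivAt_minsq (x₂ t)).comp t (hx₂ t ht.1))) (by
          intro t ht
          have hden : 0 < a + s t := by linarith [hT t ht]
          have hq : c * s t / (a + s t) ≤ c := by
            rw [div_le_iff₀ hden]; nlinarith
          have hdt := (hd_bounds t).1
          generalize c * s t / (a + s t) = q at hq ⊢
          have e1 : min (x₁ t) 0 * x₁ t = (min (x₁ t) 0) ^ 2 := by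
            rcases le_total (x₁ t) 0 with h | h <;> simp [h, sq]
          have e2 : min (x₂ t) 0 * x₂ t = (min (x₂ t) 0) ^ 2 := by
            rcases le_total (x₂ t) 0 with h | h <;> simp [h, sq]
          have u0 := min_le_right (x₁ t) 0
          have v0 := min_le_right (x₂ t) 0
          have u1 := min_le_left (x₁ t) 0
          have v1 := min_le_left (x₂ t) 0
          generalize min (x₁ t) 0 = u at *
          generalize min (x₂ t) 0 = v at *
          have i1 : u * x₂ t ≤ u * v := mul_le_mul_of_nonpos_left v1 u0
          have i2 : v * x₁ t ≤ u * v := by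
            rw [mul_comm u v]; exact mul_le_mul_of_nonpos_left u1 v0
          have i3 := mul_le_mul_of_nonneg_left i1 hr₂.le
          have i4 := mul_le_mul_of_nonneg_left i2 hr₁.le
          have i5 : (q - ν - d t - r₁) * u ^ 2 ≤ c * u ^ 2 :=
            mul_le_mul_of_nonneg_right (by linarith) (sq_nonneg u)
          have i6 : (q - ν - r₂) * v ^ 2 ≤ c * v ^ 2 :=
            mul_le_mul_of_nonneg_right (by linarith) (sq_nonneg v)
          have i7 := mul_nonneg (add_pos hr₁ hr₂).le (sq_nonneg (u - v))
          have e : 2 * u * (-(ν + d t) * x₁ t + q * x₁ t - r₁ * x₁ t + r₂ * x₂ t) +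
              2 * v * (-ν * x₂ t + q * x₂ t + r₁ * x₁ t - r₂ * x₂ t)
              = 2 * ((q - ν - d t - r₁) * (u * x₁ t)) + 2 * ((q - ν - r₂) * (v * x₂ t))
                + 2 * (r₂ * (u * x₂ t)) + 2 * (r₁ * (v * x₁ t)) := by ring
          rw [e, e1, e2]
          nlinarith) t ht
      simp only [min_eq_right h0.2.1, min_eq_right h0.2.2] at h
      have a1 := sq_nonneg (min (x₁ t) 0)
      have a2 := sq_nonneg (min (x₂ t) 0)
      have b1 : min (x₁ t) 0 = 0 := pow_eq_zero_iff two_ne_zero |>.1 (by linarith)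
      have b2 : min (x₂ t) 0 = 0 := pow_eq_zero_iff two_ne_zero |>.1 (by linarith)
      exact ⟨min_eq_right_iff.1 b1, min_eq_right_iff.1 b2⟩
    intro t ht
    refine ⟨?_, hx t ht⟩
    have h := gron (fun t => (min (s t) 0) ^ 2) _ 0 T
        (fun t ht => ((hasDerivAt_minsq (s t)).comp t (hs t ht.1))) (by
          intro t ht
          have hden : 0 < a + s t := by linarith [hT t ht]
          obtain ⟨y1, y2⟩ := hx t ht
          have hdt : 0 < d t := hb₁.trans_le (hd_bounds t).1
          rw [zero_mul]
          rcases le_total (s t) 0 with h | h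
          · rw [min_eq_left h]
            have hq : m * s t / (a + s t) ≤ 0 :=
              div_nonpos_of_nonpos_of_nonneg (mul_nonpos_of_nonneg_of_nonpos hm.le h) hden.le
            refine mul_nonpos_of_nonpos_of_nonneg (by linarith) ?_
            have j1 := mul_nonneg hdt.le (by linarith : 0 ≤ s_in - s t)
            have j2 := mul_nonpos_of_nonpos_of_nonneg hq y1
            have j3 := mul_nonpos_of_nonpos_of_nonneg hq y2
            have j4 : 0 ≤ b * ν * x₁ t := by positivity
            linarith
          · rw [min_eq_right h]; simp) t ht
    simp only [min_eq_right h0.1] at h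
    have a1 := sq_nonneg (min (s t) 0)
    have b1 : min (s t) 0 = 0 := pow_eq_zero_iff two_ne_zero |>.1 (by linarith)
    exact min_eq_right_iff.1 b1
  have hsa : ∀ t, 0 ≤ t → -a < s t := by
    by_contra! hcon
    obtain ⟨τ, hτ, hsτ⟩ := hcon
    have hcont : ContinuousOn s (Set.Icc 0 τ) :=
      fun t ht => (hs t ht.1).continuousAt.continuousWithinAt
    have hcl : IsClosed (Set.Icc 0 τ ∩ s ⁻¹' Set.Iic (-a / 2)) :=
      hcont.preimage_isClosed_of_isClosed isClosed_Icc isClosed_Iic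
    have hcp : IsCompact (Set.Icc 0 τ ∩ s ⁻¹' Set.Iic (-a / 2)) :=
      isCompact_Icc.of_isClosed_subset hcl Set.inter_subset_left
    obtain ⟨T, hT, hTl⟩ := hcp.exists_isLeast
      ⟨τ, ⟨hτ, le_refl τ⟩, show s τ ≤ -a / 2 by linarith⟩
    have hTs : s T ≤ -a / 2 := hT.2
    have hlt : ∀ t ∈ Set.Ico 0 T, -a / 2 < s t := by
      intro t ht
      by_contra! h
      have := hTl ⟨⟨ht.1, ht.2.le.trans hT.1.2⟩, h⟩
      linarith [ht.2]
    have hT0 : 0 < T := by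
      rcases hT.1.1.eq_or_lt with h | h
      · rw [← h] at hTs; linarith [h0.1]
      · exact h
    have hge : -a / 2 ≤ s T := by
      have hc' : ContinuousWithinAt s (Set.Iio T) T :=
        (hs T hT.1.1).continuousAt.continuousWithinAt
      refine ge_of_tendsto hc' ?_
      filter_upwards [Ico_mem_nhdsLT hT0] with t ht
      exact (hlt t ht).le
    have := (key T (fun t ht => by
      rcases ht.2.eq_or_lt with h | h
      · rw [h]; linarith
      · linarith [hlt t ⟨ht.1, h⟩]) T ⟨hT0.le, le_refl T⟩).1
    linarith
  have hpos : ∀ t, 0 ≤ t → 0 ≤ s t ∧ 0 ≤ x₁ t ∧ 0 ≤ x₂ t := fun t ht =>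
    key t (fun u hu => hsa u hu.1) t ⟨ht, le_refl t⟩
  have hmc : 1 ≤ m / c := (one_le_div hc).2 hcm
  have hp0 : ∀ t, 0 ≤ t → 0 ≤ p t := by
    intro t ht
    obtain ⟨h1, h2, h3⟩ := hpos t ht
    rw [hp]; positivity
  have hϑ0 : 0 < ϑ := by rw [hϑ]; exact lt_min hb₁ hν
  have hϑ1 : ϑ ≤ b₁ := by rw [hϑ]; exact min_le_left _ _
  have hϑ2 : ϑ ≤ ν := by rw [hϑ]; exact min_le_right _ _
  have hpe : p = fun t => s t + (m / c) * (x₁ t + x₂ t) := funext hp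
  have hM : ϑ * (s_in * b₂ / ϑ) = s_in * b₂ := by field_simp
  generalize s_in * b₂ / ϑ = M at hM ⊢
  have hbound : ∀ t, 0 ≤ t → p t - M ≤ (p 0 - M) * exp (-ϑ * t) := by
    intro T hT
    refine gron (fun t => p t - M) _ (-ϑ) T (fun t ht => by
      rw [hpe]
      exact ((hs t ht.1).add (((hx₁ t ht.1).add (hx₂ t ht.1)).const_mul (m / c))).sub_const M)
      ?_ T ⟨hT, le_refl T⟩
    intro t ht
    obtain ⟨y0, y1, y2⟩ := hpos t ht.1
    obtain ⟨d1, d2⟩ := hd_bounds t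
    simp only [hp]
    have hq : m * s t / (a + s t) = (m / c) * (c * s t / (a + s t)) := by
      have : a + s t ≠ 0 := by positivity
      field_simp
    rw [hq]
    generalize c * s t / (a + s t) = q
    generalize m / c = k at *
    have k1 := mul_le_mul_of_nonneg_right d2 hs_in.le
    have k2 := mul_le_mul_of_nonneg_right (hϑ1.trans d1) y0
    have k3 := mul_le_mul_of_nonneg_right (hϑ1.trans d1) (mul_nonneg (by linarith : 0 ≤ k) y1)
    have k4 := mul_le_mul_of_nonneg_right hϑ2 (mul_nonneg (by linarith : 0 ≤ k) y2)
    have k5 := mul_le_mul_of_nonneg_right (hb1.trans hmc) (mul_nonneg hν.le y1)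
    linear_combination k1 + k2 + k3 + k4 + k5 - hM
  have hlim : Tendsto (fun t => M + (p 0 - M) * exp (-ϑ * t)) atTop (nhds M) := by
    have h1 : Tendsto (fun t : ℝ => -ϑ * t) atTop atBot :=
      tendsto_id.const_mul_atTop_of_neg (by linarith)
    simpa using ((tendsto_exp_atBot.comp h1).const_mul (p 0 - M)).const_add M
  have hmain : ∀ ε > 0, ∃ T ≥ (0:ℝ), ∀ t ≥ T, 0 ≤ p t ∧ p t ≤ M + ε := by
    intro ε hε
    obtain ⟨T, hT⟩ := eventually_atTop.1 (hlim.eventually_lt_const (by linarith : M < M + ε))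
    refine ⟨max T 0, le_max_right _ _, fun t ht => ?_⟩
    have t0 : 0 ≤ t := (le_max_right _ _).trans ht
    have := hT t ((le_max_left _ _).trans ht)
    exact ⟨hp0 t t0, by linarith [hbound t t0]⟩
  refine ⟨?_, hmain⟩
  refine le_of_forall_pos_le_add fun ε hε => ?_
  obtain ⟨T, -, hT⟩ := hmain ε hε
  refine limsup_le_of_le ?_ ?_
  · exact IsBoundedUnder.isCoboundedUnder_le
      ⟨0, eventually_map.2 (eventually_atTop.2 ⟨T, fun t ht => (hT t ht).1⟩)⟩
  · exact eventually_atTop.2 ⟨T, fun t ht => (hT t ht).2⟩
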